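/- For every point-shift F and every n ∈ ℕ, μ_0(0 ∈ F_ω^n(ω)) = E_{μ_0}[1/l_n(0)], where l_n(0) := #{y ∈ ω : F_ω^n(y) = F_ω^n(0)} and F_ω^n(ω) denotes the image of ω under the n-th iterate of F_ω. Moreover, μ_0(0 ∈ F_ω^∞(ω)) = E_{μ_0}[1/l_∞(0)], where F_ω^∞(ω) := ⋂_{n≥0} F_ω^n(ω), l_∞(0) is the cardinality of the foil L(0) of the origin, and 1/l_∞(0) := 0 when L(0) is infinite. -/

import Mathlib

open Function Set MeasureTheory ProbabilityTheory
open scoped ENNReal NNReal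

namespace PointShift

/-- Points of the grid `ℤ^d`. -/
abbrev Pt (d : ℕ) := Fin d → ℤ

/-- Configurations: subsets of the grid `ℤ^d`, identified with `{0,1}`-valued
functions, equipped with the product σ-algebra. -/
abbrev Conf (d : ℕ) := Pt d → Bool

/-- The shift `θ_t ω = ω - t`. -/
def shift {d : ℕ} (t : Pt d) (ω : Conf d) : Conf d := fun x => ω (x + t)

/-- The support of a configuration, as a subset of `ℤ^d`. -/
def pts {d : ℕ} (ω : Conf d) : Set (Pt d) := {x | ω x = true}

/-- `g` is a point-map: it is measurable and selects a point of every
configuration having a point at the origin. -/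
def IsPointMap {d : ℕ} (g : Conf d → Pt d) : Prop :=
  Measurable g ∧ ∀ ω : Conf d, ω 0 = true → ω (g ω) = true

/-- The point-shift associated with a point-map `g`: `F_ω x = x + g (θ_x ω)`. -/
def Fps {d : ℕ} (g : Conf d → Pt d) (ω : Conf d) (x : Pt d) : Pt d :=
  x + g (shift x ω)

/-- `μ` is a stationary point process on the grid: a shift-invariant probability
measure with a point at the origin with positive probability. -/
def IsStationaryPP {d : ℕ} (μ : Measure (Conf d)) : Prop :=
  IsProbabilityMeasure μ ∧ (∀ t : Pt d, μ.map (shift t) = μ) ∧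
    0 < μ {ω : Conf d | ω 0 = true}

/-- The Palm probability of `μ`: `μ` conditioned on having a point at the origin. -/
noncomputable def Palm {d : ℕ} (μ : Measure (Conf d)) : Measure (Conf d) :=
  μ[|{ω : Conf d | ω 0 = true}]

/-- The foil of the point `x` in the configuration `ω`, for the point-shift of `g`. -/
def foilOn {d : ℕ} (g : Conf d → Pt d) (ω : Conf d) (x : Pt d) : Set (Pt d) :=
  {y | ω y = true ∧ ∃ n : ℕ, (Fps g ω)^[n] y = (Fps g ω)^[n] x}

/-- The connected component of the point `x` in the functional graph `G^F(ω)`. -/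
def compOn {d : ℕ} (g : Conf d → Pt d) (ω : Conf d) (x : Pt d) : Set (Pt d) :=
  {y | ω y = true ∧ ∃ m n : ℕ, (Fps g ω)^[m] x = (Fps g ω)^[n] y}

/-- `K` is a directed cycle of the functional graph of `f`: a finite set of
distinct points `c 0, …, c (k-1)` (with `k ≥ 1`) such that `f (c i) = c ((i+1) % k)`. -/
def IsCycle {X : Type*} (f : X → X) (K : Set X) : Prop :=
  ∃ (k : ℕ) (c : ℕ → X), 0 < k ∧
    (∀ i < k, ∀ j < k, c i = c j → i = j) ∧
    (∀ i < k, f (c i) = c ((i + 1) % k)) ∧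
    K = c '' {i | i < k}

end PointShift

namespace PointShift

variable {d : ℕ} {g : Conf d → Pt d}

/-- The fiber of `x` under the `n`-th iterate of the point-shift of `g`. -/
def iterFiber (g : Conf d → Pt d) (n : ℕ) (ω : Conf d) (x : Pt d) : Set (Pt d) :=
  {y | ω y = true ∧ (Fps g ω)^[n] y = x}

theorem measurable_shift (t : Pt d) : Measurable (shift t : Conf d → Conf d) :=
  measurable_pi_lambda _ fun x => measurable_pi_apply (x + t)

theorem shift_shift (s t : Pt d) (ω : Conf d) : shift s (shift t ω) = shift (s + t) ω := by
  funext x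
  simp [shift, add_assoc]

theorem iterate_Fps_shift (g : Conf d → Pt d) (n : ℕ) (t : Pt d) (ω : Conf d) (x : Pt d) :
    (Fps g (shift t ω))^[n] x + t = (Fps g ω)^[n] (x + t) := by
  have h : Semiconj (· + t) (Fps g (shift t ω)) (Fps g ω) := fun x => by
    simp only [Fps, shift_shift]
    abel
  exact h.iterate_right n x

theorem measurable_iterate_Fps (hg : Measurable g) (n : ℕ) (x : Pt d) :
    Measurable fun ω : Conf d => (Fps g ω)^[n] x := by
  induction n with
  | zero => exact measurable_const
  | succ n ih =>
    have h : Measurable fun p : Conf d × Pt d => Fps g p.1 p.2 :=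
      measurable_from_prod_countable_left fun z =>
        (hg.comp (measurable_shift z)).const_add z
    simp only [iterate_succ_apply']
    exact h.comp (measurable_id.prodMk ih)

theorem mapsTo_Fps_pts (hg : IsPointMap g) (ω : Conf d) : MapsTo (Fps g ω) (pts ω) (pts ω) := by
  intro x hx
  have h := hg.2 (shift x ω) (by simpa [shift, pts] using hx)
  rw [shift, add_comm] at h
  exact h

theorem antitone_image_iterate_Fps (hg : IsPointMap g) (ω : Conf d) :
    Antitone fun n => (Fps g ω)^[n] '' pts ω := by
  refine antitone_nat_of_succ_le fun n => ?_
  rintro _ ⟨y, hy, rfl⟩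
  exact ⟨Fps g ω y, mapsTo_Fps_pts hg ω hy, (iterate_succ_apply _ n y).symm⟩

theorem mem_image_iterate_iff (n : ℕ) (ω : Conf d) (x : Pt d) :
    x ∈ (Fps g ω)^[n] '' pts ω ↔ ((iterFiber g n ω x).encard : ℝ≥0∞) ≠ 0 := by
  rw [Ne, ENat.toENNReal_eq_zero, Set.encard_eq_zero, ← Ne, ← Set.nonempty_iff_ne_empty]
  rfl

theorem iterFiber_shift (n : ℕ) (t : Pt d) (ω : Conf d) (x : Pt d) :
    iterFiber g n (shift t ω) x = Equiv.addRight t ⁻¹' iterFiber g n ω (x + t) := by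
  ext y
  simp only [iterFiber, mem_ofPred_eq, mem_preimage, Equiv.coe_addRight, ← iterate_Fps_shift,
    add_left_inj]
  rfl

theorem encard_iterFiber_shift (n : ℕ) (t : Pt d) (ω : Conf d) (x : Pt d) :
    (iterFiber g n (shift t ω) x).encard = (iterFiber g n ω (x + t)).encard := by
  rw [iterFiber_shift, Set.encard_preimage_of_bijective (Equiv.bijective _)]

theorem encard_eq_tsum_indicator {α : Type*} (s : Set α) :
    (s.encard : ℝ≥0∞) = ∑' y, s.indicator (fun _ => (1 : ℝ≥0∞)) y := by
  rw [← tsum_subtype s (fun _ => (1 : ℝ≥0∞)), ENNReal.tsum_set_one]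

theorem measurableSet_mem_iterFiber (hg : Measurable g) (n : ℕ) (x y : Pt d) :
    MeasurableSet {ω : Conf d | y ∈ iterFiber g n ω x} :=
  (measurableSet_eq_fun (measurable_pi_apply y) measurable_const).inter
    (measurableSet_eq_fun (measurable_iterate_Fps hg n y) measurable_const)

theorem measurable_encard_iterFiber (hg : Measurable g) (n : ℕ) (x : Pt d) :
    Measurable fun ω : Conf d => ((iterFiber g n ω x).encard : ℝ≥0∞) := by
  simp only [encard_eq_tsum_indicator]
  exact Measurable.tsum fun y =>
    (measurable_const (a := (1 : ℝ≥0∞))).indicator (measurableSet_mem_iterFiber hg n x y)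

theorem measurable_inv_encard_iterFiber (hg : Measurable g) (n : ℕ) (x : Pt d) :
    Measurable fun ω : Conf d =>
      ((iterFiber g n ω ((Fps g ω)^[n] x)).encard : ℝ≥0∞)⁻¹ := by
  have h : Measurable fun p : Conf d × Pt d => ((iterFiber g n p.1 p.2).encard : ℝ≥0∞) :=
    measurable_from_prod_countable_left fun z => measurable_encard_iterFiber hg n z
  exact (h.comp (measurable_id.prodMk (measurable_iterate_Fps hg n x))).inv

theorem measurableSet_zero_mem : MeasurableSet {ω : Conf d | ω 0 = true} :=
  measurableSet_eq_fun (measurable_pi_apply 0) measurable_const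

/-- The mass transport principle on the grid. -/
theorem lintegral_tsum_transport {μ : Measure (Conf d)}
    (hinv : ∀ t : Pt d, μ.map (shift t) = μ) {k : Pt d → Conf d → ℝ≥0∞}
    (hk : ∀ y, Measurable (k y)) :
    ∫⁻ ω, ∑' y, k y ω ∂μ = ∫⁻ ω, ∑' x, k (-x) (shift x ω) ∂μ := by
  rw [lintegral_tsum fun y => (hk y).aemeasurable,
    lintegral_tsum (f := fun x ω => k (-x) (shift x ω))
      fun x => ((hk (-x)).comp (measurable_shift x)).aemeasurable,
    ← (Equiv.neg (Pt d)).tsum_eq]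
  refine tsum_congr fun x => ?_
  rw [← lintegral_map (hk (-x)) (measurable_shift x), hinv]
  rfl

/-- Mass transport from each point to its image under the `n`-th iterate, the mass
depending on the source only through the target. -/
theorem setLIntegral_iterate_transport {μ : Measure (Conf d)}
    (hinv : ∀ t : Pt d, μ.map (shift t) = μ) (hg : Measurable g) (n : ℕ)
    {w : Conf d → Pt d → ℝ≥0∞} (hw : ∀ x, Measurable fun ω => w ω x)
    (hw_shift : ∀ t ω x, w (shift t ω) x = w ω (x + t)) :
    ∫⁻ ω in {ω : Conf d | ω 0 = true}, w ω ((Fps g ω)^[n] 0) ∂μ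
      = ∫⁻ ω, (iterFiber g n ω 0).encard * w ω 0 ∂μ := by
  classical
  have hk : ∀ y, Measurable
      ({ω : Conf d | (0 : Pt d) ∈ iterFiber g n ω y}.indicator fun ω => w ω y) := fun y =>
    (hw y).indicator (measurableSet_mem_iterFiber hg n y 0)
  have key := lintegral_tsum_transport hinv hk
  rw [← lintegral_indicator measurableSet_zero_mem]
  convert key using 2 with ω ω
  · funext ω
    rw [tsum_eq_single ((Fps g ω)^[n] 0)]
    · simp [indicator, iterFiber]
    · intro y hy
      simp [indicator, iterFiber, hy.symm]
  · funext ω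
    rw [encard_eq_tsum_indicator, ← ENNReal.tsum_mul_right]
    refine tsum_congr fun x => ?_
    have h : (0 : Pt d) ∈ iterFiber g n (shift x ω) (-x) ↔ x ∈ iterFiber g n ω 0 := by
      rw [iterFiber_shift]
      simp
    simp only [indicator, mem_ofPred_eq, h, hw_shift, neg_add_cancel, ite_mul, one_mul, zero_mul]

theorem ae_encard_iterFiber_ne_top {μ : Measure (Conf d)} [IsFiniteMeasure μ]
    (hinv : ∀ t : Pt d, μ.map (shift t) = μ) (hg : Measurable g) (n : ℕ) :
    ∀ᵐ ω ∂μ, ((iterFiber g n ω 0).encard : ℝ≥0∞) ≠ ∞ := by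
  have h := setLIntegral_iterate_transport hinv hg n (w := fun _ _ => 1)
    (fun _ => measurable_const) (fun _ _ _ => rfl)
  simp only [lintegral_one, mul_one] at h
  refine (ae_lt_top (measurable_encard_iterFiber hg n 0) ?_).mono fun ω hω => hω.ne
  rw [← h]
  exact measure_ne_top _ _

theorem measurableSet_zero_mem_image_iterate (hg : Measurable g) (n : ℕ) :
    MeasurableSet {ω : Conf d | 0 ∈ (Fps g ω)^[n] '' pts ω} := by
  simp only [mem_image_iterate_iff]
  exact (measurable_encard_iterFiber hg n 0 (measurableSet_singleton 0)).compl

theorem palm_zero_mem_image_iterate {μ : Measure (Conf d)} [IsFiniteMeasure μ]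
    (hinv : ∀ t : Pt d, μ.map (shift t) = μ) (hg : IsPointMap g) (n : ℕ) :
    Palm μ {ω : Conf d | 0 ∈ (Fps g ω)^[n] '' pts ω}
      = ∫⁻ ω, ((iterFiber g n ω ((Fps g ω)^[n] 0)).encard : ℝ≥0∞)⁻¹ ∂(Palm μ) := by
  have hsub : {ω : Conf d | 0 ∈ (Fps g ω)^[n] '' pts ω} ⊆ {ω : Conf d | ω 0 = true} := by
    rintro ω ⟨y, hy, h0⟩
    have h := (mapsTo_Fps_pts hg ω).iterate n hy
    rw [h0] at h
    exact h
  rw [Palm, ProbabilityTheory.cond_apply measurableSet_zero_mem, inter_eq_right.2 hsub,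
    ProbabilityTheory.cond, lintegral_smul_measure, smul_eq_mul,
    setLIntegral_iterate_transport hinv hg.1 n
      (w := fun ω x => ((iterFiber g n ω x).encard : ℝ≥0∞)⁻¹)
      (fun x => (measurable_encard_iterFiber hg.1 n x).inv)
      (fun t ω x => by rw [encard_iterFiber_shift]),
    ← lintegral_indicator_one (measurableSet_zero_mem_image_iterate hg.1 n)]
  congr 1
  refine lintegral_congr_ae ?_
  filter_upwards [ae_encard_iterFiber_ne_top hinv hg.1 n] with ω hω
  by_cases h : 0 ∈ (Fps g ω)^[n] '' pts ω
  · rw [indicator_of_mem (mem_ofPred_eq ▸ h), Pi.one_apply,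
      ENNReal.mul_inv_cancel ((mem_image_iterate_iff n ω 0).1 h) hω]
  · rw [indicator_of_notMem (mem_ofPred_eq ▸ h), not_not.1 (mt (mem_image_iterate_iff n ω 0).2 h), zero_mul]

theorem monotone_iterFiber_iterate (g : Conf d → Pt d) (ω : Conf d) (x : Pt d) :
    Monotone fun n => iterFiber g n ω ((Fps g ω)^[n] x) := by
  refine monotone_nat_of_le_succ fun n y hy => ⟨hy.1, ?_⟩
  rw [iterate_succ_apply', iterate_succ_apply', hy.2]

theorem foilOn_eq_iUnion (g : Conf d → Pt d) (ω : Conf d) (x : Pt d) :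
    foilOn g ω x = ⋃ n, iterFiber g n ω ((Fps g ω)^[n] x) := by
  ext y
  simp [foilOn, iterFiber]

theorem inv_encard_foilOn (g : Conf d → Pt d) (ω : Conf d) (x : Pt d) :
    ((foilOn g ω x).encard : ℝ≥0∞)⁻¹
      = ⨅ n, ((iterFiber g n ω ((Fps g ω)^[n] x)).encard : ℝ≥0∞)⁻¹ := by
  rw [← ENNReal.inv_iSup, foilOn_eq_iUnion]
  simp only [← Measure.count_apply (MeasurableSet.of_discrete (α := Pt d))]
  rw [(monotone_iterFiber_iterate g ω x).measure_iUnion]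

end PointShift

/-- `μ₀(0 ∈ F^n(ω)) = E_{μ₀}[1/l_n(0)]` for every `n`, and
`μ₀(0 ∈ F^∞(ω)) = E_{μ₀}[1/l_∞(0)]`, where `l_∞(0)` is the cardinality of the foil of
the origin and `1/l_∞(0) = 0` when this foil is infinite (the inverse is taken in
`ℝ≥0∞` of the extended cardinality, so that `(⊤)⁻¹ = 0`). -/
theorem stmt_16 {d : ℕ} (hd : 0 < d)
    (μ : Measure (PointShift.Conf d)) [IsProbabilityMeasure μ]
    (hinv : ∀ t : PointShift.Pt d, μ.map (PointShift.shift t) = μ)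
    (hpos : 0 < μ {ω : PointShift.Conf d | ω 0 = true})
    (g : PointShift.Conf d → PointShift.Pt d) (hg : PointShift.IsPointMap g)
    (n : ℕ) :
    PointShift.Palm μ {ω : PointShift.Conf d |
        0 ∈ (PointShift.Fps g ω)^[n] '' PointShift.pts ω}
      = ∫⁻ ω, (({y : PointShift.Pt d | ω y = true ∧
          (PointShift.Fps g ω)^[n] y = (PointShift.Fps g ω)^[n] 0}.encard : ℝ≥0∞))⁻¹
          ∂(PointShift.Palm μ) ∧
    PointShift.Palm μ {ω : PointShift.Conf d |
        0 ∈ ⋂ m : ℕ, (PointShift.Fps g ω)^[m] '' PointShift.pts ω}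
      = ∫⁻ ω, (((PointShift.foilOn g ω 0).encard : ℝ≥0∞))⁻¹ ∂(PointShift.Palm μ) := by
  refine ⟨PointShift.palm_zero_mem_image_iterate hinv hg n, ?_⟩
  have : IsProbabilityMeasure (PointShift.Palm μ) := cond_isProbabilityMeasure hpos.ne'
  have hanti : Antitone fun m : ℕ => {ω : PointShift.Conf d |
      0 ∈ (PointShift.Fps g ω)^[m] '' PointShift.pts ω} := fun i j hij ω hω =>
    PointShift.antitone_image_iterate_Fps hg ω hij hω
  simp only [mem_iInter, ofPred_forall, PointShift.inv_encard_foilOn]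
  rw [hanti.measure_iInter
      (fun m => (PointShift.measurableSet_zero_mem_image_iterate hg.1 m).nullMeasurableSet)
      ⟨0, measure_ne_top _ _⟩,
    lintegral_iInf (fun m => PointShift.measurable_inv_encard_iterFiber hg.1 m 0)]
  · exact iInf_congr fun m => PointShift.palm_zero_mem_image_iterate hinv hg m
  · intro i j hij ω
    exact ENNReal.inv_le_inv.2 (ENat.toENNReal_le.2
      (Set.encard_le_encard (PointShift.monotone_iterFiber_iterate g ω 0 hij)))
  · rw [← PointShift.palm_zero_mem_image_iterate hinv hg 0]
    exact measure_ne_top _ _
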